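/- Let (M,d) be a complete cone metric space over a real Banach space E with cone P, where P is normal with normal constant K. Let S and T be self-maps of M such that (a) T is sequentially continuous, (b) S(M) ⊆ T(M), (c) S and T commute, and (d) d(Sx,Sy) ≤ a·d(Tx,Ty) for all x, y ∈ M, where 0 ≤ a < 1. Then S and T have a unique common fixed point. -/

import Mathlib

/-- `P` is a cone in the real Banach space `E`. -/
def IsCone {E : Type*} [NormedAddCommGroup E] [NormedSpace ℝ E] (P : Set E) : Prop :=
  IsClosed P ∧ P.Nonempty ∧ P ≠ {0} ∧
    (∀ a b : ℝ, 0 ≤ a → 0 ≤ b → ∀ x ∈ P, ∀ y ∈ P, a • x + b • y ∈ P) ∧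
    P ∩ (-P) = {0}

/-- The partial order induced by the cone `P`: `x ≤ y` iff `y - x ∈ P`. -/
def ConeLe {E : Type*} [NormedAddCommGroup E] [NormedSpace ℝ E] (P : Set E) (x y : E) : Prop :=
  y - x ∈ P

/-- `x ≪ y` iff `y - x ∈ interior P`. -/
def ConeLt {E : Type*} [NormedAddCommGroup E] [NormedSpace ℝ E] (P : Set E) (x y : E) : Prop :=
  y - x ∈ interior P

/-- `P` is a normal cone with normal constant `K`. -/
def IsNormalCone {E : Type*} [NormedAddCommGroup E] [NormedSpace ℝ E] (P : Set E) (K : ℝ) : Prop :=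
  0 < K ∧ ∀ x y : E, ConeLe P 0 x → ConeLe P x y → ‖x‖ ≤ K * ‖y‖

/-- `d` is a cone metric on `M` with respect to the cone `P`. -/
def IsConeMetric {E M : Type*} [NormedAddCommGroup E] [NormedSpace ℝ E]
    (P : Set E) (d : M → M → E) : Prop :=
  (∀ x y : M, ConeLe P 0 (d x y)) ∧
  (∀ x y : M, d x y = 0 ↔ x = y) ∧
  (∀ x y : M, d x y = d y x) ∧
  (∀ x y z : M, ConeLe P (d x y) (d x z + d z y))

/-- Convergence of a sequence in a cone metric space. -/
def ConeConv {E M : Type*} [NormedAddCommGroup E] [NormedSpace ℝ E]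
    (P : Set E) (d : M → M → E) (u : ℕ → M) (x : M) : Prop :=
  ∀ c : E, ConeLt P 0 c → ∃ n₀ : ℕ, ∀ n ≥ n₀, ConeLt P (d (u n) x) c

/-- Cauchy sequences in a cone metric space. -/
def ConeCauchy {E M : Type*} [NormedAddCommGroup E] [NormedSpace ℝ E]
    (P : Set E) (d : M → M → E) (u : ℕ → M) : Prop :=
  ∀ c : E, ConeLt P 0 c → ∃ n₀ : ℕ, ∀ n ≥ n₀, ∀ m ≥ n₀, ConeLt P (d (u n) (u m)) c

/-- Completeness of a cone metric space. -/
def ConeComplete {E M : Type*} [NormedAddCommGroup E] [NormedSpace ℝ E]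
    (P : Set E) (d : M → M → E) : Prop :=
  ∀ u : ℕ → M, ConeCauchy P d u → ∃ x : M, ConeConv P d u x

/-- Sequential continuity of a self-map of a cone metric space. -/
def ConeSeqContinuous {E M : Type*} [NormedAddCommGroup E] [NormedSpace ℝ E]
    (P : Set E) (d : M → M → E) (T : M → M) : Prop :=
  ∀ (u : ℕ → M) (x : M), ConeConv P d u x → ConeConv P d (fun n => T (u n)) (T x)

/-- `(S, T)` is a pair of generalized Zamfirescu operators with constants `a`, `b`, `c`. -/
def IsGZO {E M : Type*} [NormedAddCommGroup E] [NormedSpace ℝ E]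
    (P : Set E) (d : M → M → E) (S T : M → M) (a b c : ℝ) : Prop :=
  0 ≤ a ∧ a < 1 ∧ 0 ≤ b ∧ b < 1/2 ∧ 0 ≤ c ∧ c < 1/2 ∧
    ∀ x y : M,
      ConeLe P (d (S x) (S y)) (a • d (T x) (T y)) ∨
      ConeLe P (d (S x) (S y)) (b • (d (S x) (T x) + d (S y) (T y))) ∨
      ConeLe P (d (S x) (S y)) (c • (d (S x) (T y) + d (S y) (T x)))

/-- `(S, T)` is a generalized weak contraction. -/
def IsGWC {E M : Type*} [NormedAddCommGroup E] [NormedSpace ℝ E]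
    (P : Set E) (d : M → M → E) (S T : M → M) : Prop :=
  ∃ δ L : ℝ, 0 < δ ∧ δ < 1 ∧ 0 ≤ L ∧
    ∀ x y : M, ConeLe P (d (S x) (S y)) (δ • d (T x) (T y) + L • d (S x) (T x))

section ConeOrder

variable {E : Type*} [NormedAddCommGroup E] [NormedSpace ℝ E] {P : Set E}

lemma IsCone.add_mem (hP : IsCone P) {x y : E} (hx : x ∈ P) (hy : y ∈ P) : x + y ∈ P := by
  simpa using hP.2.2.2.1 1 1 zero_le_one zero_le_one x hx y hy

lemma IsCone.smul_mem (hP : IsCone P) {r : ℝ} (hr : 0 ≤ r) {x : E} (hx : x ∈ P) :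
    r • x ∈ P := by
  simpa using hP.2.2.2.1 r 0 hr le_rfl x hx x hx

lemma IsCone.zero_mem (hP : IsCone P) : (0 : E) ∈ P := by
  obtain ⟨x, hx⟩ := hP.2.1
  simpa using hP.smul_mem le_rfl hx

lemma IsCone.eq_zero (hP : IsCone P) {x : E} (hx : x ∈ P) (hx' : -x ∈ P) : x = 0 := by
  have h : x ∈ P ∩ (-P) := ⟨hx, hx'⟩
  rwa [hP.2.2.2.2] at h

lemma IsCone.add_mem_interior (hP : IsCone P) {x y : E} (hx : x ∈ P) (hy : y ∈ interior P) :
    x + y ∈ interior P := by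
  have hopen : IsOpen ((fun z => x + z) '' interior P) :=
    (isOpenMap_add_left x) _ isOpen_interior
  refine interior_maximal ?_ hopen ⟨y, hy, rfl⟩
  rintro _ ⟨z, hz, rfl⟩
  exact hP.add_mem hx (interior_subset hz)

lemma IsCone.smul_mem_interior (hP : IsCone P) {r : ℝ} (hr : 0 < r) {x : E}
    (hx : x ∈ interior P) : r • x ∈ interior P := by
  have hopen : IsOpen ((fun z : E => r • z) '' interior P) :=
    (isOpenMap_smul₀ hr.ne') _ isOpen_interior
  refine interior_maximal ?_ hopen ⟨x, hx, rfl⟩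
  rintro _ ⟨z, hz, rfl⟩
  exact hP.smul_mem hr.le (interior_subset hz)

lemma ConeLe.trans (hP : IsCone P) {x y z : E} (hxy : ConeLe P x y) (hyz : ConeLe P y z) :
    ConeLe P x z := by
  simpa [ConeLe] using hP.add_mem hyz hxy

lemma ConeLe.add (hP : IsCone P) {x y x' y' : E} (h : ConeLe P x y) (h' : ConeLe P x' y') :
    ConeLe P (x + x') (y + y') := by
  simpa [ConeLe, add_sub_add_comm] using hP.add_mem h h'

lemma ConeLe.smul (hP : IsCone P) {r : ℝ} (hr : 0 ≤ r) {x y : E} (h : ConeLe P x y) :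
    ConeLe P (r • x) (r • y) := by
  simpa [ConeLe, smul_sub] using hP.smul_mem hr h

lemma ConeLe.trans_coneLt (hP : IsCone P) {x y z : E} (hxy : ConeLe P x y)
    (hyz : ConeLt P y z) : ConeLt P x z := by
  simpa [ConeLt] using hP.add_mem_interior hxy hyz

lemma ConeLt.add (hP : IsCone P) {x y x' y' : E} (h : ConeLt P x y) (h' : ConeLt P x' y') :
    ConeLt P (x + x') (y + y') := by
  simpa [ConeLt, add_sub_add_comm] using hP.add_mem_interior (interior_subset h) h'

/-- A nonnegative element lying below every interior point of the cone vanishes. -/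
lemma IsCone.eq_zero_of_forall_coneLt (hP : IsCone P) (hint : (interior P).Nonempty) {x : E}
    (hx : x ∈ P) (h : ∀ c, ConeLt P 0 c → ConeLt P x c) : x = 0 := by
  obtain ⟨c, hc⟩ := hint
  refine hP.eq_zero hx ?_
  have hlim : Filter.Tendsto (fun n : ℕ => (1 / ((n : ℝ) + 1)) • c - x) Filter.atTop
      (nhds (-x)) := by
    simpa using
      ((tendsto_one_div_add_atTop_nhds_zero_nat (𝕜 := ℝ)).smul_const c).sub_const x
  refine hP.1.mem_of_tendsto hlim (Filter.Eventually.of_forall fun n => ?_)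
  refine interior_subset (h _ ?_)
  simpa [ConeLt] using hP.smul_mem_interior (Nat.one_div_pos_of_nat (n := n) (α := ℝ)) hc

/-- An element dominated by a proper multiple of itself vanishes. -/
lemma IsCone.eq_zero_of_coneLe_smul (hP : IsCone P) {a : ℝ} (ha1 : a < 1) {x : E}
    (hx : x ∈ P) (h : ConeLe P x (a • x)) : x = 0 := by
  refine hP.eq_zero hx ?_
  have hpos : 0 < 1 - a := sub_pos.mpr ha1
  have key : (1 - a)⁻¹ • (a • x - x) = -x := by
    rw [show a • x - x = (1 - a) • (-x) by module, inv_smul_smul₀ hpos.ne']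
  exact key ▸ hP.smul_mem (inv_nonneg.mpr hpos.le) h

end ConeOrder

section ConeMetric

variable {E M : Type*} [NormedAddCommGroup E] [NormedSpace ℝ E] {P : Set E} {d : M → M → E}

lemma IsConeMetric.mem (hd : IsConeMetric P d) (x y : M) : d x y ∈ P := by
  simpa [ConeLe] using hd.1 x y

/-- Limits in a cone metric space are unique. -/
lemma ConeConv.unique (hP : IsCone P) (hint : (interior P).Nonempty) (hd : IsConeMetric P d)
    {u : ℕ → M} {x y : M} (hx : ConeConv P d u x) (hy : ConeConv P d u y) : x = y := by
  rw [← hd.2.1]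
  refine hP.eq_zero_of_forall_coneLt hint (hd.mem x y) fun c hc => ?_
  have hc2 : ConeLt P 0 ((1 / 2 : ℝ) • c) := by
    simpa [ConeLt] using hP.smul_mem_interior (by norm_num : (0 : ℝ) < 1 / 2)
      (by simpa [ConeLt] using hc)
  obtain ⟨n, hn⟩ := hx _ hc2
  obtain ⟨m, hm⟩ := hy _ hc2
  have hsum := (hn _ (le_max_left n m)).add hP (hm _ (le_max_right n m))
  rw [hd.2.2.1 _ x, ← add_smul] at hsum
  norm_num at hsum
  exact (hd.2.2.2 x y _).trans_coneLt hP hsum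

/-- A sequence whose consecutive distances shrink by a factor `a < 1` is Cauchy. -/
lemma coneCauchy_of_coneLe_smul (hP : IsCone P) (hd : IsConeMetric P d) {a : ℝ} (ha : 0 ≤ a)
    (ha1 : a < 1) {y : ℕ → M}
    (hy : ∀ n, ConeLe P (d (y (n + 1)) (y (n + 2))) (a • d (y n) (y (n + 1)))) :
    ConeCauchy P d y := by
  have hpos : 0 < 1 - a := sub_pos.mpr ha1
  have hstep : ∀ n, ConeLe P (d (y n) (y (n + 1))) (a ^ n • d (y 0) (y 1)) := by
    intro n
    induction n with
    | zero => simpa [ConeLe] using hP.zero_mem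
    | succ n ih =>
      have h := (hy n).trans hP (ih.smul hP ha)
      rwa [smul_smul, ← pow_succ'] at h
  have hbound : ∀ k n, ConeLe P (d (y n) (y (n + k)))
      ((a ^ n * (1 - a)⁻¹) • d (y 0) (y 1)) := by
    intro k
    induction k with
    | zero =>
      intro n
      have h0 : d (y n) (y n) = 0 := (hd.2.1 _ _).mpr rfl
      simpa [ConeLe, h0] using hP.smul_mem
        (mul_nonneg (pow_nonneg ha n) (inv_nonneg.mpr hpos.le)) (hd.mem (y 0) (y 1))
    | succ k ih =>
      intro n
      have h := (hd.2.2.2 (y n) (y (n + 1 + k)) (y (n + 1))).trans hP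
        ((hstep n).add hP (ih (n + 1)))
      rw [← add_smul] at h
      have hcoef : a ^ n + a ^ (n + 1) * (1 - a)⁻¹ = a ^ n * (1 - a)⁻¹ := by
        field_simp
        ring
      rwa [hcoef, show n + 1 + k = n + (k + 1) by ring] at h
  intro c hc
  have hlim : Filter.Tendsto (fun n : ℕ => c - (a ^ n * (1 - a)⁻¹) • d (y 0) (y 1))
      Filter.atTop (nhds (c - 0)) := by
    simpa using (((tendsto_pow_atTop_nhds_zero_of_lt_one ha ha1).mul_const
      (1 - a)⁻¹).smul_const (d (y 0) (y 1))).const_sub c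
  obtain ⟨n₀, hn₀⟩ := Filter.eventually_atTop.mp
    (hlim.eventually (isOpen_interior.mem_nhds hc))
  have hle : ∀ n ≥ n₀, ∀ m ≥ n, ConeLt P (d (y n) (y m)) c := by
    intro n hn m hm
    obtain ⟨k, rfl⟩ := Nat.exists_eq_add_of_le hm
    exact (hbound k n).trans_coneLt hP (hn₀ n hn)
  refine ⟨n₀, fun n hn m hm => ?_⟩
  rcases le_total n m with h | h
  · exact hle n hn m h
  · exact hd.2.2.1 (y m) (y n) ▸ hle m hm n h

end ConeMetric

/-- Jungck's common fixed point theorem in a complete cone metric space. -/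
theorem jungck_cone_fixed_point {E M : Type*} [NormedAddCommGroup E] [NormedSpace ℝ E]
    [CompleteSpace E] [Nonempty M]
    (P : Set E) (K : ℝ) (d : M → M → E)
    (hP : IsCone P) (hint : (interior P).Nonempty) (hK : IsNormalCone P K)
    (hd : IsConeMetric P d) (hcomp : ConeComplete P d)
    (S T : M → M) (a : ℝ)
    (hT : ConeSeqContinuous P d T)
    (hrange : Set.range S ⊆ Set.range T)
    (hcomm : ∀ x : M, S (T x) = T (S x))
    (ha : 0 ≤ a) (ha1 : a < 1)
    (hcontr : ∀ x y : M, ConeLe P (d (S x) (S y)) (a • d (T x) (T y))) :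
    ∃! z : M, S z = z ∧ T z = z := by
  have hle : ∀ x y, ConeLe P (d (S x) (S y)) (d (T x) (T y)) := fun x y =>
    (hcontr x y).trans hP <| by
      simpa [ConeLe, sub_smul] using hP.smul_mem (sub_nonneg.mpr ha1.le) (hd.mem (T x) (T y))
  choose f hf using fun x => hrange ⟨x, rfl⟩
  let x : ℕ → M := fun n => f^[n] (Classical.arbitrary M)
  have hx : ∀ n, T (x (n + 1)) = S (x n) := fun n => by
    simp only [x, Function.iterate_succ_apply', hf]
  have hcauchy : ConeCauchy P d (fun n => T (x n)) := by
    refine coneCauchy_of_coneLe_smul hP hd ha ha1 fun n => ?_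
    have h := hcontr (x n) (x (n + 1))
    rwa [← hx, ← hx] at h
  obtain ⟨t, ht⟩ := hcomp _ hcauchy
  have hTT := hT _ _ ht
  have hST : ConeConv P d (fun n => S (T (x n))) (S t) := by
    intro c hc
    obtain ⟨n₀, hn₀⟩ := hTT c hc
    exact ⟨n₀, fun n hn => (hle _ _).trans_coneLt hP (hn₀ n hn)⟩
  have hST' : ConeConv P d (fun n => S (T (x n))) (T t) := by
    intro c hc
    obtain ⟨n₀, hn₀⟩ := hTT c hc
    refine ⟨n₀, fun n hn => ?_⟩
    have h : ConeLt P (d (T (T (x (n + 1)))) (T t)) c := hn₀ (n + 1) (by omega)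
    rwa [hx, ← hcomm] at h
  have hcoin : S t = T t := hST.unique hP hint hd hST'
  have hfix : S (S t) = S t := by
    rw [← hd.2.1]
    refine hP.eq_zero_of_coneLe_smul ha1 (hd.mem _ _) ?_
    have h := hcontr (S t) t
    rwa [← hcomm, ← hcoin] at h
  refine ⟨S t, ⟨hfix, by rw [← hcomm, ← hcoin, hfix]⟩, ?_⟩
  rintro w ⟨hSw, hTw⟩
  rw [← hd.2.1]
  refine hP.eq_zero_of_coneLe_smul ha1 (hd.mem _ _) ?_
  have h := hcontr w (S t)
  rwa [hSw, hTw, ← hcomm, ← hcoin, hfix] at h
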